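/- arXiv:1501.00445 — 4 statements merged into one kernel-verified Lean document; each statement's English description precedes it below -/
import Mathlib

section
/- Let B be a commutative integral domain over a field k of characteristic zero. Then B is semi-rigid if and only if ML(B) = ker ∂ for every nonzero locally nilpotent k-derivation ∂ of B. -/
variable {k B : Type*}

/-- A locally nilpotent `k`-derivation. -/
def IsLND [CommRing k] [CommRing B] [Algebra k B] (D : Derivation k B B) : Prop :=
  ∀ a : B, ∃ n : ℕ, ((D.toLinearMap : Module.End k B) ^ n) a = 0

/-- `B` is semi-rigid. -/
def SemiRigid (k B : Type*) [CommRing k] [CommRing B] [Algebra k B] : Prop :=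
  ∀ (D E : Derivation k B B), IsLND D → IsLND E → D ≠ 0 → E ≠ 0 →
    ∀ i : ℕ, LinearMap.ker ((D.toLinearMap : Module.End k B) ^ (i + 1)) =
      LinearMap.ker ((E.toLinearMap : Module.End k B) ^ (i + 1))

/-- Makar-Limanov invariant. -/
def ML (k B : Type*) [CommRing k] [CommRing B] [Algebra k B] : Set B :=
  {b : B | ∀ D : Derivation k B B, IsLND D → D b = 0}

namespace Derivation

section CommRing

variable [CommRing k] [CommRing B] [Algebra k B]

lemma iterate_mul_of_apply_eq_zero (D : Derivation k B B) {a : B} (ha : D a = 0) (b : B) (n : ℕ) :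
    D^[n] (a * b) = a * D^[n] b := by
  induction n with
  | zero => rfl
  | succ n ih => simp [Function.iterate_succ_apply', ih, ha]

/-- The top-order term of the Leibniz rule for iterates of a derivation. -/
lemma exists_iterate_mul_eq (D : Derivation k B B) (m n : ℕ) (a b : B)
    (ha : D^[m + 1] a = 0) (hb : D^[n + 1] b = 0) :
    ∃ c : ℕ, 0 < c ∧ D^[m + n] (a * b) = c * (D^[m] a * D^[n] b) := by
  induction m generalizing a b n with
  | zero => exact ⟨1, one_pos, by simpa using D.iterate_mul_of_apply_eq_zero ha b n⟩
  | succ m ihm =>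
    induction n generalizing a b with
    | zero =>
      refine ⟨1, one_pos, ?_⟩
      simpa [mul_comm] using D.iterate_mul_of_apply_eq_zero hb a (m + 1)
    | succ n ihn =>
      obtain ⟨c, hc, h₁⟩ := ihm (n + 1) (D a) b ha hb
      obtain ⟨d, -, h₂⟩ := ihn a (D b) ha hb
      refine ⟨d + c, by positivity, ?_⟩
      rw [show m + 1 + (n + 1) = m + (n + 1) + 1 by ring, Function.iterate_succ_apply, D.leibniz,
        iterate_map_add, smul_eq_mul, smul_eq_mul, mul_comm b, h₁,
        show m + (n + 1) = m + 1 + n by ring, h₂]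
      simp only [Function.iterate_succ_apply]
      push_cast
      ring

lemma iterate_pow_self (D : Derivation k B B) {r : B} (hr : D (D r) = 0) (n : ℕ) :
    D^[n] (r ^ n) = n.factorial * D r ^ n := by
  induction n with
  | zero => simp
  | succ n ih =>
    have h : D (((n + 1 : ℕ) : B) * D r) = 0 := by simp [hr]
    have hpow : D (r ^ (n + 1)) = ((n + 1 : ℕ) : B) * D r * r ^ n := by
      rw [D.leibniz_pow]
      simp
      ring
    rw [Function.iterate_succ_apply, hpow, D.iterate_mul_of_apply_eq_zero h, ih, Nat.factorial_succ]
    push_cast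
    ring

lemma pow_mul_iterate_eq (D E : Derivation k B B) {f g : B} (hf : D f = 0) (hg : D g = 0)
    (h : ∀ b, f * D b = g * E b) (n : ℕ) (b : B) : f ^ n * D^[n] b = g ^ n * E^[n] b := by
  induction n with
  | zero => simp
  | succ n ih =>
    have hD := congrArg D ih
    simp only [leibniz, leibniz_pow, hf, hg, smul_zero, add_zero, smul_eq_mul, mul_zero] at hD
    simp only [Function.iterate_succ_apply', pow_succ]
    linear_combination f * hD + g ^ n * h (E^[n] b)

end CommRing

end Derivation

namespace IsLND

open Derivation

section CommRing

variable [CommRing k] [CommRing B] [Algebra k B] {D : Derivation k B B}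

lemma exists_iterate_eq_zero (hD : IsLND D) (b : B) : ∃ n : ℕ, D^[n] b = 0 := by
  obtain ⟨n, hn⟩ := hD b
  exact ⟨n, by simpa [Module.End.pow_apply] using hn⟩

lemma exists_iterate_ne_zero (hD : IsLND D) {b : B} (hb : b ≠ 0) :
    ∃ n : ℕ, D^[n] b ≠ 0 ∧ D^[n + 1] b = 0 := by
  by_contra! h
  obtain ⟨n, hn⟩ := hD.exists_iterate_eq_zero b
  have hne : ∀ n, D^[n] b ≠ 0 := fun n ↦ by
    induction n with
    | zero => exact hb
    | succ n ih => exact h n ih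
  exact hne n hn

/-- A nonzero locally nilpotent derivation has a local slice. -/
lemma exists_local_slice (hD : IsLND D) (h₀ : D ≠ 0) : ∃ r, D r ≠ 0 ∧ D (D r) = 0 := by
  obtain ⟨b, hb⟩ : ∃ b, D b ≠ 0 := by
    by_contra! h
    exact h₀ (Derivation.ext h)
  obtain ⟨n, hn, hn'⟩ := hD.exists_iterate_ne_zero hb
  refine ⟨D^[n] b, ?_, ?_⟩
  · rwa [← Function.iterate_succ_apply' (⇑D), Function.iterate_succ_apply]
  · rwa [← Function.iterate_succ_apply' (⇑D), ← Function.iterate_succ_apply' (⇑D),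
      Function.iterate_succ_apply]

end CommRing

variable [CommRing k] [CommRing B] [IsDomain B] [CharZero B] [Algebra k B]
  {D : Derivation k B B}

/-- The kernel of a locally nilpotent derivation is factorially closed. -/
lemma apply_eq_zero_of_mul (hD : IsLND D) {a b : B} (hab : a * b ≠ 0) (h : D (a * b) = 0) :
    D a = 0 := by
  obtain ⟨m, hm, hm'⟩ := hD.exists_iterate_ne_zero (left_ne_zero_of_mul hab)
  obtain ⟨n, hn, hn'⟩ := hD.exists_iterate_ne_zero (right_ne_zero_of_mul hab)
  obtain ⟨c, hc, hmn⟩ := D.exists_iterate_mul_eq m n a b hm' hn'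
  cases m with
  | zero => exact hm'
  | succ m =>
    rw [show m + 1 + n = m + n + 1 by ring, Function.iterate_succ_apply, h,
      iterate_map_zero] at hmn
    exact absurd hmn.symm
      (mul_ne_zero (Nat.cast_ne_zero.mpr hc.ne') (mul_ne_zero hm hn))

/-- A derivation that vanishes on `ker D` and at a local slice of `D` is zero. -/
lemma eq_zero_of_local_slice (hD : IsLND D) {r : B} (hr : D r ≠ 0) (hr' : D (D r) = 0)
    {δ : Derivation k B B} (hδ : ∀ a, D a = 0 → δ a = 0) (hδr : δ r = 0) : δ = 0 := by
  have key : ∀ (n : ℕ) (b : B), D^[n] b = 0 → δ b = 0 := fun n ↦ by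
    induction n with
    | zero => rintro b rfl; exact map_zero δ
    | succ n ih =>
      intro b hb
      have hu : D (D^[n] b) = 0 := by rwa [← Function.iterate_succ_apply' (⇑D)]
      have hs : D (n.factorial * D r ^ n) = 0 := by simp [leibniz_pow, hr']
      have hc := ih (n.factorial * D r ^ n * b - D^[n] b * r ^ n) (by
        rw [iterate_map_sub, D.iterate_mul_of_apply_eq_zero hs,
          D.iterate_mul_of_apply_eq_zero hu, D.iterate_pow_self hr']
        ring)
      rw [map_sub, leibniz, hδ _ hs, leibniz, leibniz_pow, hδ _ hu, hδr] at hc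
      simpa [hr, n.factorial_ne_zero] using hc
  ext b
  obtain ⟨n, hn⟩ := hD.exists_iterate_eq_zero b
  exact key n b hn

/-- Nonzero locally nilpotent derivations with the same kernel `A` are proportional over `A`. -/
lemma exists_mul_eq_mul {E : Derivation k B B} (hD : IsLND D) (hE : IsLND E) (hD₀ : D ≠ 0)
    (hE₀ : E ≠ 0) (h : ∀ b, D b = 0 ↔ E b = 0) :
    ∃ f g : B, f ≠ 0 ∧ g ≠ 0 ∧ D f = 0 ∧ D g = 0 ∧ ∀ b, f * D b = g * E b := by
  obtain ⟨r, hr, hr'⟩ := hD.exists_local_slice hD₀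
  obtain ⟨u, hu, hu'⟩ := hE.exists_local_slice hE₀
  have hδ : E r • D - D r • E = 0 := by
    refine hD.eq_zero_of_local_slice hr hr' (fun a ha ↦ ?_) ?_
    · simp [ha, (h a).mp ha]
    · simp [mul_comm]
  have hfg : ∀ b, E r * D b = D r * E b := fun b ↦ by
    simpa [sub_eq_zero] using DFunLike.congr_fun hδ b
  refine ⟨E r, D r, mt (h r).mpr hr, hr, ?_, hr', hfg⟩
  refine hD.apply_eq_zero_of_mul (b := D u) ?_ ?_
  · rw [hfg]
    exact mul_ne_zero hr hu
  · rw [hfg, leibniz, hr', (h _).mpr hu']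
    simp

/-- The kernel of a nonzero locally nilpotent derivation determines its filtration. -/
lemma ker_pow_eq {E : Derivation k B B} (hD : IsLND D) (hE : IsLND E) (hD₀ : D ≠ 0)
    (hE₀ : E ≠ 0) (h : ∀ b, D b = 0 ↔ E b = 0) (n : ℕ) :
    LinearMap.ker ((D.toLinearMap : Module.End k B) ^ n) =
      LinearMap.ker ((E.toLinearMap : Module.End k B) ^ n) := by
  obtain ⟨f, g, hf, hg, hDf, hDg, hfg⟩ := hD.exists_mul_eq_mul hE hD₀ hE₀ h
  ext b
  have hb := D.pow_mul_iterate_eq E hDf hDg hfg n b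
  simp only [LinearMap.mem_ker, Module.End.pow_apply]
  change D^[n] b = 0 ↔ E^[n] b = 0
  rw [← mul_eq_zero_iff_left (pow_ne_zero n hf), hb, mul_eq_zero_iff_left (pow_ne_zero n hg)]

end IsLND

theorem stmt0 [Field k] [CharZero k] [CommRing B] [IsDomain B] [Algebra k B] :
    SemiRigid k B ↔
      ∀ D : Derivation k B B, IsLND D → D ≠ 0 → ML k B = {b : B | D b = 0} := by
  have : CharZero B := charZero_of_injective_algebraMap (algebraMap k B).injective
  constructor
  · intro h D hD hD₀
    ext b
    refine ⟨fun hb ↦ hb D hD, fun hb E hE ↦ ?_⟩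
    by_cases hE₀ : E = 0
    · simp [hE₀]
    · have hker := SetLike.ext_iff.mp (h D E hD hE hD₀ hE₀ 0) b
      simp only [zero_add, pow_one, LinearMap.mem_ker] at hker
      exact hker.mp hb
  · intro h D E hD hE hD₀ hE₀ i
    refine hD.ker_pow_eq hE hD₀ hE₀ (fun b ↦ ?_) (i + 1)
    exact Set.ext_iff.mp ((h D hD hD₀).symm.trans (h E hE hE₀)) b
end

section
/- Let Ψ: A → B be a k-algebra isomorphism between two semi-rigid k-domains, each admitting a nonzero locally nilpotent derivation. Let {F_i}_{i∈ℕ} and {G_i}_{i∈ℕ} be their unique LND-filtrations, i.e. F_i = ker ∂_A^{i+1} for any (equivalently, every) nonzero ∂_A ∈ LND(A), and similarly G_i = ker ∂_B^{i+1}. Then Ψ(F_i) = G_i for every i ∈ ℕ. -/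
variable {k A B : Type*}

/-- The derivation `Ψ ∘ D ∘ Ψ⁻¹` of `B` obtained by transporting a derivation `D` of `A`
along an algebra isomorphism `Ψ : A ≃ₐ[k] B`. -/
def Derivation.conjAlgEquiv [CommRing k] [CommRing A] [Algebra k A] [CommRing B] [Algebra k B]
    (Ψ : A ≃ₐ[k] B) (D : Derivation k A A) : Derivation k B B :=
  Derivation.mk' (Ψ.toLinearMap ∘ₗ D.toLinearMap ∘ₗ Ψ.symm.toLinearMap) fun a b => by
    simp

theorem Derivation.conjAlgEquiv_apply [CommRing k] [CommRing A] [Algebra k A] [CommRing B]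
    [Algebra k B] (Ψ : A ≃ₐ[k] B) (D : Derivation k A A) (a : A) :
    D.conjAlgEquiv Ψ (Ψ a) = Ψ (D a) := by
  exact congrArg (fun x => Ψ (D x)) (Ψ.symm_apply_apply a)

theorem Derivation.conjAlgEquiv_pow_apply [CommRing k] [CommRing A] [Algebra k A] [CommRing B]
    [Algebra k B] (Ψ : A ≃ₐ[k] B) (D : Derivation k A A) (n : ℕ) (a : A) :
    (((D.conjAlgEquiv Ψ).toLinearMap : Module.End k B) ^ n) (Ψ a) =
      Ψ (((D.toLinearMap : Module.End k A) ^ n) a) := by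
  induction n generalizing a with
  | zero => simp
  | succ n ih =>
    rw [pow_succ, pow_succ, Module.End.mul_apply, Module.End.mul_apply, ← ih]
    exact congrArg _ (D.conjAlgEquiv_apply Ψ a)

theorem IsLND.conjAlgEquiv [CommRing k] [CommRing A] [Algebra k A] [CommRing B] [Algebra k B]
    (Ψ : A ≃ₐ[k] B) {D : Derivation k A A} (hD : IsLND D) : IsLND (D.conjAlgEquiv Ψ) := by
  intro b
  obtain ⟨a, rfl⟩ := Ψ.surjective b
  obtain ⟨n, hn⟩ := hD a
  exact ⟨n, by rw [Derivation.conjAlgEquiv_pow_apply, hn, map_zero]⟩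

theorem Derivation.conjAlgEquiv_ne_zero [CommRing k] [CommRing A] [Algebra k A] [CommRing B]
    [Algebra k B] (Ψ : A ≃ₐ[k] B) {D : Derivation k A A} (hD : D ≠ 0) :
    D.conjAlgEquiv Ψ ≠ 0 := by
  refine fun h => hD (Derivation.ext fun a => Ψ.injective ?_)
  rw [← Derivation.conjAlgEquiv_apply, h]
  simp

theorem stmt4 [Field k] [CharZero k] [CommRing A] [IsDomain A] [Algebra k A]
    [CommRing B] [IsDomain B] [Algebra k B]
    (Ψ : A ≃ₐ[k] B)
    (hA : SemiRigid k A) (hB : SemiRigid k B)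
    (hexA : ∃ D : Derivation k A A, IsLND D ∧ D ≠ 0)
    (hexB : ∃ D : Derivation k B B, IsLND D ∧ D ≠ 0) :
    ∀ (DA : Derivation k A A) (DB : Derivation k B B),
      IsLND DA → DA ≠ 0 → IsLND DB → DB ≠ 0 → ∀ i : ℕ,
        (⇑Ψ) '' {a : A | ((DA.toLinearMap : Module.End k A) ^ (i + 1)) a = 0} =
          {b : B | ((DB.toLinearMap : Module.End k B) ^ (i + 1)) b = 0} := by
  intro DA DB hDA hDA0 hDB hDB0 i
  have hker := hB (DA.conjAlgEquiv Ψ) DB (hDA.conjAlgEquiv Ψ) hDB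
    (Derivation.conjAlgEquiv_ne_zero Ψ hDA0) hDB0 i
  ext b
  obtain ⟨a, rfl⟩ := Ψ.surjective b
  have hmem := SetLike.ext_iff.mp hker (Ψ a)
  rw [LinearMap.mem_ker, LinearMap.mem_ker, Derivation.conjAlgEquiv_pow_apply,
    map_eq_zero_iff Ψ Ψ.injective] at hmem
  rw [Ψ.injective.mem_set_image]
  exact hmem
end

section
/- For integers n ≥ 1 and e ≥ 1 let R_{n,e} := k[X,Y,Z]/⟨X^nY − (Y² − X^eZ)² − 1⟩. Then for all n ≥ 1 and all e_1, e_2 ≥ 1, the cylinders are isomorphic: R_{n,e_1} ⊗_k k[T] ≅ R_{n,e_2} ⊗_k k[T] as k-algebras, i.e. R_{n,e_1}[T] ≅ R_{n,e_2}[T]. -/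
open MvPolynomial

noncomputable section

variable (k : Type*) [Field k] [CharZero k]

/-- The ideal `⟨XⁿY - (Y² - XᵉZ)² - 1⟩` of `k[X,Y,Z]` (variables `X = 0`, `Y = 1`, `Z = 2`). -/
def RneIdeal (n e : ℕ) : Ideal (MvPolynomial (Fin 3) k) :=
  Ideal.span {X 0 ^ n * X 1 - (X 1 ^ 2 - X 0 ^ e * X 2) ^ 2 - 1}

/-- `R_{n,e} = k[X,Y,Z]/⟨XⁿY - (Y² - XᵉZ)² - 1⟩`. -/
def Rne (n e : ℕ) : Type _ := MvPolynomial (Fin 3) k ⧸ RneIdeal k n e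

instance (n e : ℕ) : CommRing (Rne k n e) := Ideal.Quotient.commRing _

instance (n e : ℕ) : Algebra k (Rne k n e) := Ideal.Quotient.algebra k

set_option linter.unusedSectionVars false

/-- The class in `R_{n,e}` of the `i`-th variable. -/
def Rne.gen (n e : ℕ) (i : Fin 3) : Rne k n e :=
  Ideal.Quotient.mk (RneIdeal k n e) (X i)

theorem Rne.relation (n e : ℕ) :
    Rne.gen k n e 0 ^ n * Rne.gen k n e 1
      = (Rne.gen k n e 1 ^ 2 - Rne.gen k n e 0 ^ e * Rne.gen k n e 2) ^ 2 + 1 := by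
  have h : Ideal.Quotient.mk (RneIdeal k n e)
      (X 0 ^ n * X 1 - (X 1 ^ 2 - X 0 ^ e * X 2) ^ 2 - 1) = 0 :=
    Ideal.Quotient.eq_zero_iff_mem.2 (Ideal.subset_span rfl)
  simp only [map_sub, map_mul, map_pow, map_one] at h
  have h' : Rne.gen k n e 0 ^ n * Rne.gen k n e 1
      - (Rne.gen k n e 1 ^ 2 - Rne.gen k n e 0 ^ e * Rne.gen k n e 2) ^ 2 - 1 = 0 := h
  linear_combination h'

/-- The algebra map out of `R_{n,e}` determined by a solution of the defining equation. -/
def Rne.lift {C : Type*} [CommRing C] [Algebra k C] (n e : ℕ) (x y z : C)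
    (h : x ^ n * y = (y ^ 2 - x ^ e * z) ^ 2 + 1) : Rne k n e →ₐ[k] C :=
  Ideal.Quotient.liftₐ (RneIdeal k n e) (aeval ![x, y, z]) fun p hp => by
    have hle : RneIdeal k n e ≤ RingHom.ker (aeval ![x, y, z] : MvPolynomial (Fin 3) k →ₐ[k] C) := by
      rw [RneIdeal, Ideal.span_le, Set.singleton_subset_iff]
      simp [RingHom.mem_ker, h]
    exact hle hp

theorem Rne.lift_gen {C : Type*} [CommRing C] [Algebra k C] (n e : ℕ) (x y z : C)
    (h : x ^ n * y = (y ^ 2 - x ^ e * z) ^ 2 + 1) (i : Fin 3) :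
    Rne.lift k n e x y z h (Rne.gen k n e i) = ![x, y, z] i :=
  (Ideal.Quotient.lift_mk _ _ _).trans (aeval_X _ i)

variable {k} in
theorem Rne.algHom_ext {C : Type*} [CommRing C] [Algebra k C] {n e : ℕ}
    {f g : Rne k n e →ₐ[k] C} (h : ∀ i, f (Rne.gen k n e i) = g (Rne.gen k n e i)) : f = g :=
  Ideal.Quotient.algHom_ext k (MvPolynomial.algHom_ext h)

theorem Rne.isLeftRegular_gen_zero {n e : ℕ} (hn : 1 ≤ n) (he : 1 ≤ e) :
    IsLeftRegular (Rne.gen k n e 0) := by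
  rw [isLeftRegular_iff_right_eq_zero_of_mul]
  intro r hr
  obtain ⟨p, rfl⟩ := Ideal.Quotient.mk_surjective r
  have hp : X 0 * p ∈ RneIdeal k n e := Ideal.Quotient.eq_zero_iff_mem.1 hr
  refine Ideal.Quotient.eq_zero_iff_mem.2 ?_
  rw [RneIdeal, Ideal.mem_span_singleton] at hp ⊢
  obtain ⟨q, hq⟩ := hp
  have hX : Prime (X 0 : MvPolynomial (Fin 3) k) := MvPolynomial.X_prime
  rcases hX.dvd_or_dvd (Dvd.intro _ hq) with h | ⟨q', rfl⟩
  · exfalso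
    obtain ⟨g, hg⟩ := h
    have := congrArg (MvPolynomial.eval ![(0 : k), 0, 0]) hg
    simp [show n ≠ 0 by omega, show e ≠ 0 by omega] at this
  · exact ⟨q', mul_left_cancel₀ hX.ne_zero (by rw [hq]; ring)⟩

theorem Polynomial.isLeftRegular_C {R : Type*} [CommRing R] {r : R} (hr : IsLeftRegular r) :
    IsLeftRegular (Polynomial.C r) := by
  intro p q h
  ext i
  refine hr ?_
  simpa using congrArg (fun f => Polynomial.coeff f i) h

/-- Solving for the last coordinate of the surface with exponent `b + 2`, given a point of the
cylinder over the surface with exponent `b + 1`. -/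
theorem exists_coordinate_of_lower {C : Type*} [CommRing C] {a b : ℕ} {c x y z s v T : C}
    (hc : 4 * c = 1) (hv : v = y ^ 2 - x ^ (b + 1) * z) (h : x ^ (a + 1) * y = v ^ 2 + 1)
    (hT : T = c * y * z + x * s) :
    ∃ w, x ^ (b + 2) * w = (y + 2 * v * x ^ (b + 1) * T + x ^ (a + 2 * b + 3) * T ^ 2) ^ 2
      - (v + x ^ (a + b + 2) * T) := by
  refine ⟨z * (x ^ a * y + x ^ b * z * v) + 4 * y * v * s + 4 * x ^ b * v ^ 2 * T ^ 2
    + 2 * y * x ^ (a + b + 1) * T ^ 2 + 4 * v * x ^ (a + 2 * b + 2) * T ^ 3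
    + x ^ (2 * a + 3 * b + 4) * T ^ 4 - x ^ a * T, ?_⟩
  linear_combination x ^ (b + 1) * z * h + (1 + x ^ (b + 1) * z * v) * hv
    - 4 * y * v * x ^ (b + 1) * hT - x ^ (b + 1) * y ^ 2 * v * z * hc

/-- Solving for the last coordinate of the surface with exponent `b + 1` and for the cylinder
coordinate, given a point of the cylinder over the surface with exponent `b + 2`. -/
theorem exists_coordinates_of_higher {C : Type*} [CommRing C] {a b : ℕ} {c x y z u T : C}
    (hc : 4 * c = 1) (hu : u = y ^ 2 - x ^ (b + 2) * z) (h : x ^ (a + 1) * y = u ^ 2 + 1) :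
    ∃ w s, x ^ (b + 1) * w = (y - 2 * u * x ^ (b + 1) * T + x ^ (a + 2 * b + 3) * T ^ 2) ^ 2
        - (u - x ^ (a + b + 2) * T) ∧
      T = c * (y - 2 * u * x ^ (b + 1) * T + x ^ (a + 2 * b + 3) * T ^ 2) * w + x * s := by
  obtain ⟨α, hα⟩ : ∃ α, α = -2 * u * x ^ b * T + x ^ (a + 2 * b + 2) * T ^ 2 := ⟨_, rfl⟩
  obtain ⟨β, hβ⟩ : ∃ β, β = z + 4 * x ^ b * u ^ 2 * T ^ 2 + 2 * y * x ^ (a + b + 1) * T ^ 2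
    - 4 * u * x ^ (a + 2 * b + 2) * T ^ 3 + x ^ (2 * a + 3 * b + 4) * T ^ 4 + x ^ a * T := ⟨_, rfl⟩
  have hy : y - 2 * u * x ^ (b + 1) * T + x ^ (a + 2 * b + 3) * T ^ 2 = y + x * α := by
    rw [hα]; ring
  refine ⟨x * β - 4 * y * u * T,
    T * (x ^ a * y + x ^ (b + 1) * z * u) - c * (α * (x * β - 4 * y * u * T) + y * β), ?_, ?_⟩
  · rw [hβ]
    linear_combination hu
  · rw [hy]
    linear_combination y ^ 2 * u * T * hc - T * h - u * T * hu

theorem polynomial_Rne_equiv_succ (a b : ℕ) :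
    Nonempty (Polynomial (Rne k (a + 1) (b + 2)) ≃ₐ[k] Polynomial (Rne k (a + 1) (b + 1))) := by
  let A := Polynomial (Rne k (a + 1) (b + 1))
  let B := Polynomial (Rne k (a + 1) (b + 2))
  let gA : Fin 3 → A := fun i => Polynomial.C (Rne.gen k (a + 1) (b + 1) i)
  let gB : Fin 3 → B := fun i => Polynomial.C (Rne.gen k (a + 1) (b + 2) i)
  let S : A := Polynomial.X
  let T : B := Polynomial.X
  have regA : IsLeftRegular (gA 0) :=
    Polynomial.isLeftRegular_C (Rne.isLeftRegular_gen_zero k (by omega) (by omega))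
  have regB : IsLeftRegular (gB 0) :=
    Polynomial.isLeftRegular_C (Rne.isLeftRegular_gen_zero k (by omega) (by omega))
  have h4 : (4 : k) * 4⁻¹ = 1 := mul_inv_cancel₀ (by norm_num)
  have hcA : (4 : A) * algebraMap k A 4⁻¹ = 1 := by
    simpa only [map_mul, map_one, map_ofNat] using congrArg (algebraMap k A) h4
  have hcB : (4 : B) * algebraMap k B 4⁻¹ = 1 := by
    simpa only [map_mul, map_one, map_ofNat] using congrArg (algebraMap k B) h4
  have relA : gA 0 ^ (a + 1) * gA 1 = (gA 1 ^ 2 - gA 0 ^ (b + 1) * gA 2) ^ 2 + 1 := by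
    simpa only [map_sub, map_mul, map_pow, map_one, map_add] using
      congrArg Polynomial.C (Rne.relation k (a + 1) (b + 1))
  have relB : gB 0 ^ (a + 1) * gB 1 = (gB 1 ^ 2 - gB 0 ^ (b + 2) * gB 2) ^ 2 + 1 := by
    simpa only [map_sub, map_mul, map_pow, map_one, map_add] using
      congrArg Polynomial.C (Rne.relation k (a + 1) (b + 2))
  obtain ⟨v, hv⟩ : ∃ v, v = gA 1 ^ 2 - gA 0 ^ (b + 1) * gA 2 := ⟨_, rfl⟩
  obtain ⟨u, hu⟩ : ∃ u, u = gB 1 ^ 2 - gB 0 ^ (b + 2) * gB 2 := ⟨_, rfl⟩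
  rw [← hv] at relA
  rw [← hu] at relB
  obtain ⟨T', hT'⟩ : ∃ T', T' = algebraMap k A 4⁻¹ * gA 1 * gA 2 + gA 0 * S := ⟨_, rfl⟩
  obtain ⟨z', hz'⟩ := exists_coordinate_of_lower hcA hv relA hT'
  obtain ⟨z'', s'', hz'', hs''⟩ := exists_coordinates_of_higher (T := T) hcB hu relB
  obtain ⟨y', hy'⟩ : ∃ y', y' = gA 1 + 2 * v * gA 0 ^ (b + 1) * T'
    + gA 0 ^ (a + 2 * b + 3) * T' ^ 2 := ⟨_, rfl⟩
  obtain ⟨y'', hy''⟩ : ∃ y'', y'' = gB 1 - 2 * u * gB 0 ^ (b + 1) * T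
    + gB 0 ^ (a + 2 * b + 3) * T ^ 2 := ⟨_, rfl⟩
  rw [← hy'] at hz'
  rw [← hy''] at hz'' hs''
  have rel' : gA 0 ^ (a + 1) * y' = (y' ^ 2 - gA 0 ^ (b + 2) * z') ^ 2 + 1 := by
    rw [hz', hy']
    linear_combination relA
  have rel'' : gB 0 ^ (a + 1) * y'' = (y'' ^ 2 - gB 0 ^ (b + 1) * z'') ^ 2 + 1 := by
    rw [hz'', hy'']
    linear_combination relB
  let φ : B →ₐ[k] A := Polynomial.eval₂AlgHom (Rne.lift k (a + 1) (b + 2) (gA 0) y' z' rel') T'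
    fun _ => Commute.all _ _
  let ψ : A →ₐ[k] B := Polynomial.eval₂AlgHom
    (Rne.lift k (a + 1) (b + 1) (gB 0) y'' z'' rel'') s'' fun _ => Commute.all _ _
  have φg (i : Fin 3) : φ (gB i) = ![gA 0, y', z'] i :=
    (Polynomial.eval₂_C _ _).trans (Rne.lift_gen k _ _ _ _ _ rel' i)
  have ψg (i : Fin 3) : ψ (gA i) = ![gB 0, y'', z''] i :=
    (Polynomial.eval₂_C _ _).trans (Rne.lift_gen k _ _ _ _ _ rel'' i)
  have φ0 : φ (gB 0) = gA 0 := φg 0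
  have φ1 : φ (gB 1) = y' := φg 1
  have φ2 : φ (gB 2) = z' := φg 2
  have φT : φ T = T' := Polynomial.eval₂_X _ _
  have ψ0 : ψ (gA 0) = gB 0 := ψg 0
  have ψ1 : ψ (gA 1) = y'' := ψg 1
  have ψ2 : ψ (gA 2) = z'' := ψg 2
  have ψS : ψ S = s'' := Polynomial.eval₂_X _ _
  have ψT' : ψ T' = T := by
    rw [hT', hs'']
    simp only [map_add, map_mul, ψ0, ψ1, ψ2, ψS, AlgHom.commutes]
  have φu : φ u = v + gA 0 ^ (a + b + 2) * T' := by
    rw [hu]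
    simp only [map_sub, map_mul, map_pow, φ0, φ1, φ2]
    linear_combination -hz'
  have ψv : ψ v = u - gB 0 ^ (a + b + 2) * T := by
    rw [hv]
    simp only [map_sub, map_mul, map_pow, ψ0, ψ1, ψ2]
    linear_combination -hz''
  have ψy' : ψ y' = gB 1 := by
    rw [hy']
    simp only [map_add, map_mul, map_pow, map_ofNat, ψ0, ψ1, ψT', ψv]
    rw [hy'']
    ring
  have φy'' : φ y'' = gA 1 := by
    rw [hy'']
    simp only [map_add, map_sub, map_mul, map_pow, map_ofNat, φ0, φ1, φT, φu]
    rw [hy']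
    ring
  have ψz' : ψ z' = gB 2 := by
    refine regB.pow (b + 2) ?_
    have := congrArg ψ hz'
    simp only [map_add, map_sub, map_mul, map_pow, ψ0, ψT', ψv, ψy'] at this
    linear_combination this - hu
  have φz'' : φ z'' = gA 2 := by
    refine regA.pow (b + 1) ?_
    have := congrArg φ hz''
    simp only [map_sub, map_mul, map_pow, φ0, φT, φu, φy''] at this
    linear_combination this - hv
  have φs'' : φ s'' = S := by
    refine regA ?_
    have := congrArg φ hs''
    simp only [map_add, map_mul, φ0, φT, φy'', φz'', AlgHom.commutes] at this
    linear_combination hT' - this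
  refine ⟨AlgEquiv.ofAlgHom φ ψ ?_ ?_⟩
  · refine Polynomial.algHom_ext' (Rne.algHom_ext fun i => ?_) ?_
    · change φ (ψ (gA i)) = gA i
      rw [ψg]
      fin_cases i
      exacts [φ0, φy'', φz'']
    · change φ (ψ S) = S
      rw [ψS, φs'']
  · refine Polynomial.algHom_ext' (Rne.algHom_ext fun i => ?_) ?_
    · change ψ (φ (gB i)) = gB i
      rw [φg]
      fin_cases i
      exacts [ψ0, ψy', ψz']
    · change ψ (φ T) = T
      rw [φT, ψT']

theorem polynomial_Rne_equiv_one (a b : ℕ) :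
    Nonempty (Polynomial (Rne k (a + 1) (b + 1)) ≃ₐ[k] Polynomial (Rne k (a + 1) 1)) := by
  induction b with
  | zero => exact ⟨AlgEquiv.refl⟩
  | succ b ih =>
    obtain ⟨f⟩ := ih
    obtain ⟨g⟩ := polynomial_Rne_equiv_succ k a b
    exact ⟨g.trans f⟩

/-- Cylinders over the `R_{n,e}` with the same `n` are isomorphic:
`R_{n,e₁}[T] ≅ R_{n,e₂}[T]`. -/
theorem stmt18 (n e₁ e₂ : ℕ) (hn : 1 ≤ n) (he₁ : 1 ≤ e₁) (he₂ : 1 ≤ e₂) :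
    Nonempty (Polynomial (Rne k n e₁) ≃ₐ[k] Polynomial (Rne k n e₂)) := by
  obtain ⟨a, rfl⟩ := Nat.exists_eq_add_of_le' hn
  obtain ⟨b₁, rfl⟩ := Nat.exists_eq_add_of_le' he₁
  obtain ⟨b₂, rfl⟩ := Nat.exists_eq_add_of_le' he₂
  obtain ⟨f⟩ := polynomial_Rne_equiv_one k a b₁
  obtain ⟨g⟩ := polynomial_Rne_equiv_one k a b₂
  exact ⟨f.trans g.symm⟩

end
end

section
/- Let d ≥ 2, c ∈ k \ {0}, Q(X,S) ∈ k[X,S] arbitrary, and P(X,S) = S^d + X·Q(X,S) + c. Then for all integers n, m ≥ 1 the cylinders over the Danielewski domains are isomorphic: B_{n,P} ⊗_k k[T] ≅ B_{m,P} ⊗_k k[T] as k-algebras, i.e. B_{n,P}[T] ≅ B_{m,P}[T], where B_{n,P} = k[X,S,Y]/⟨X^nY − P(X,S)⟩. -/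
open MvPolynomial

noncomputable section

variable (k : Type*) [Field k] [CharZero k]

/-- `P(X,S) = S^d + X·Q(X,S) + c` as an element of `k[X,S,Y]`
(variables `X = 0`, `S = 1`, `Y = 2`); `Q` is an arbitrary polynomial in `X` and `S`. -/
def Ppoly (d : ℕ) (Q : MvPolynomial (Fin 2) k) (c : k) : MvPolynomial (Fin 3) k :=
  X 1 ^ d + X 0 * aeval ![X 0, X 1] Q + C c

/-- The ideal `⟨XⁿY - P(X,S)⟩` of `k[X,S,Y]` (variables `X = 0`, `S = 1`, `Y = 2`). -/
def DanIdeal (n d : ℕ) (Q : MvPolynomial (Fin 2) k) (c : k) :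
    Ideal (MvPolynomial (Fin 3) k) :=
  Ideal.span {X 0 ^ n * X 2 - Ppoly k d Q c}

/-- The Danielewski domain `B_{n,P} = k[X,S,Y]/⟨XⁿY - P(X,S)⟩`. -/
def DanRing (n d : ℕ) (Q : MvPolynomial (Fin 2) k) (c : k) : Type _ :=
  MvPolynomial (Fin 3) k ⧸ DanIdeal k n d Q c

instance (n d : ℕ) (Q : MvPolynomial (Fin 2) k) (c : k) : CommRing (DanRing k n d Q c) :=
  Ideal.Quotient.commRing _

instance (n d : ℕ) (Q : MvPolynomial (Fin 2) k) (c : k) : Algebra k (DanRing k n d Q c) :=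
  Ideal.Quotient.algebra k

universe u

variable {F : Type*} [Field F]

theorem aeval_vecCons_two {A B : Type*} [CommRing A] [Algebra F A] [CommRing B] [Algebra F B]
    (f : A →ₐ[F] B) (Q : MvPolynomial (Fin 2) F) (x s : A) :
    f (aeval ![x, s] Q) = aeval ![f x, f s] Q := by
  rw [comp_aeval_apply]
  congr 2
  funext i
  fin_cases i <;> rfl

theorem aeval_vecCons_three {A B : Type*} [CommRing A] [Algebra F A] [CommRing B] [Algebra F B]
    (f : A →ₐ[F] B) (H : MvPolynomial (Fin 3) F) (x s z : A) :
    f (aeval ![x, s, z] H) = aeval ![f x, f s, f z] H := by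
  rw [comp_aeval_apply]
  congr 2
  funext i
  fin_cases i <;> rfl

/-- An increment of the second variable divides the increment of a polynomial. -/
theorem dvd_aeval_add_sub {A : Type*} [CommRing A] [Algebra F A]
    (Q : MvPolynomial (Fin 2) F) (x s h : A) :
    h ∣ aeval ![x, s + h] Q - aeval ![x, s] Q := by
  have key : (Ideal.Quotient.mkₐ F (Ideal.span {h})) (aeval ![x, s + h] Q) =
      (Ideal.Quotient.mkₐ F (Ideal.span {h})) (aeval ![x, s] Q) := by
    have hh : (Ideal.Quotient.mkₐ F (Ideal.span {h})) h = 0 :=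
      Ideal.Quotient.eq_zero_iff_mem.2 (Ideal.mem_span_singleton_self h)
    rw [aeval_vecCons_two, aeval_vecCons_two, map_add, hh, add_zero]
  rw [← Ideal.mem_span_singleton]
  exact (Ideal.Quotient.mk_eq_mk_iff_sub_mem _ _).1 key

/-- First-order Taylor expansion of `S ^ d + X * Q` in the direction `X ^ (N + 1) * Z`, with a
remainder given by one polynomial over all `F`-algebras. -/
theorem exists_taylor_remainder (d N : ℕ) (Q : MvPolynomial (Fin 2) F) :
    ∃ H : MvPolynomial (Fin 3) F, ∀ {A : Type u} [CommRing A] [Algebra F A] (x s z : A),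
      (s + x ^ (N + 1) * z) ^ d + x * aeval ![x, s + x ^ (N + 1) * z] Q =
        s ^ d + x * aeval ![x, s] Q +
          x ^ (N + 1) * z * (d * s ^ (d - 1) + x * aeval ![x, s, z] H) := by
  obtain ⟨L, hL⟩ := dvd_aeval_add_sub Q (X 0 : MvPolynomial (Fin 3) F) (X 1) (X 0 ^ (N + 1) * X 2)
  obtain ⟨K, hK⟩ := Polynomial.powAddExpansion (X 1 : MvPolynomial (Fin 3) F)
    (X 0 ^ (N + 1) * X 2) d
  refine ⟨K * X 0 ^ N * X 2 + L, fun {A} _ _ x s z => ?_⟩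
  have universal : (X 1 + X 0 ^ (N + 1) * X 2 : MvPolynomial (Fin 3) F) ^ d +
      X 0 * aeval ![X 0, X 1 + X 0 ^ (N + 1) * X 2] Q =
        X 1 ^ d + X 0 * aeval ![X 0, X 1] Q +
          X 0 ^ (N + 1) * X 2 *
            ((d : MvPolynomial (Fin 3) F) * X 1 ^ (d - 1) + X 0 * (K * X 0 ^ N * X 2 + L)) := by
    linear_combination hK + X 0 * hL
  have evaluated := congrArg (aeval (R := F) ![x, s, z]) universal
  simp only [map_add, map_mul, map_pow, map_natCast, aeval_vecCons_two, aeval_X] at evaluated ⊢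
  exact evaluated

section Cylinder

variable {n d : ℕ} {Q : MvPolynomial (Fin 2) F} {c : F}

variable (n d Q c) in
/-- The coordinates `X, S, Y` of the Danielewski domain, as elements of its cylinder. -/
def cylCoord (i : Fin 3) : Polynomial (DanRing F n d Q c) :=
  Polynomial.C (Ideal.Quotient.mk (DanIdeal F n d Q c) (X i))

variable (n d Q c) in
/-- The structure map from `F[X,S,Y]` to the cylinder. -/
def toCyl : MvPolynomial (Fin 3) F →ₐ[F] Polynomial (DanRing F n d Q c) :=
  Polynomial.CAlgHom.comp (Ideal.Quotient.mkₐ F (DanIdeal F n d Q c))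

theorem toCyl_X (i : Fin 3) : toCyl n d Q c (X i) = cylCoord n d Q c i := rfl

theorem cyl_relation :
    cylCoord n d Q c 0 ^ n * cylCoord n d Q c 2 = cylCoord n d Q c 1 ^ d +
      cylCoord n d Q c 0 * aeval ![cylCoord n d Q c 0, cylCoord n d Q c 1] Q +
        algebraMap F _ c := by
  have h0 : toCyl n d Q c (X 0 ^ n * X 2 - Ppoly F d Q c) = 0 := by
    have : Ideal.Quotient.mk (DanIdeal F n d Q c) (X 0 ^ n * X 2 - Ppoly F d Q c) = 0 :=
      Ideal.Quotient.eq_zero_iff_mem.2 (Ideal.mem_span_singleton_self _)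
    exact (congrArg Polynomial.C this).trans Polynomial.C_0
  have hC : toCyl n d Q c (C c) = algebraMap F _ c := (toCyl n d Q c).commutes c
  simp only [Ppoly, map_sub, map_add, map_mul, map_pow, aeval_vecCons_two, toCyl_X, hC] at h0
  exact sub_eq_zero.1 h0

/-- Solutions `(x, s, y, t)` of the defining relation in a `F`-algebra give maps from the
cylinder. -/
theorem exists_cyl_lift {A : Type*} [CommRing A] [Algebra F A] (x s y t : A)
    (h : x ^ n * y = s ^ d + x * aeval ![x, s] Q + algebraMap F A c) :
    ∃ f : Polynomial (DanRing F n d Q c) →ₐ[F] A,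
      f (cylCoord n d Q c 0) = x ∧ f (cylCoord n d Q c 1) = s ∧
        f (cylCoord n d Q c 2) = y ∧ f Polynomial.X = t := by
  have hI : ∀ a ∈ DanIdeal F n d Q c, aeval ![x, s, y] a = 0 := by
    intro a ha
    obtain ⟨b, rfl⟩ := Ideal.mem_span_singleton.1 ha
    have hx : aeval ![x, s, y] (X 0 ^ n * X 2 - Ppoly F d Q c) = 0 := by
      simp only [Ppoly, map_sub, map_add, map_mul, map_pow, aeval_vecCons_two, aeval_X, aeval_C]
      exact sub_eq_zero.2 h
    rw [map_mul, hx, zero_mul]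
  let g : DanRing F n d Q c →ₐ[F] A := Ideal.Quotient.liftₐ _ (aeval ![x, s, y]) hI
  have hg (i : Fin 3) : g (Ideal.Quotient.mk (DanIdeal F n d Q c) (X i)) = ![x, s, y] i :=
    aeval_X _ _
  refine ⟨Polynomial.eval₂AlgHom g t fun _ => Commute.all _ _, ?_, ?_, ?_, ?_⟩
  · exact (Polynomial.eval₂_C _ _).trans (hg 0)
  · exact (Polynomial.eval₂_C _ _).trans (hg 1)
  · exact (Polynomial.eval₂_C _ _).trans (hg 2)
  · simp

/-- Maps from the cylinder are determined by the images of the coordinates and of `T`. -/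
theorem cyl_algHom_ext {A : Type*} [CommRing A] [Algebra F A]
    {f g : Polynomial (DanRing F n d Q c) →ₐ[F] A}
    (h : ∀ i, f (cylCoord n d Q c i) = g (cylCoord n d Q c i))
    (ht : f Polynomial.X = g Polynomial.X) : f = g := by
  refine Polynomial.algHom_ext' (Ideal.Quotient.algHom_ext F ?_) ht
  exact MvPolynomial.algHom_ext h

end Cylinder

/-- Modulo `X`, the element `-S / (c d)` inverts `d * S ^ (d - 1)` on the Danielewski domain. -/
theorem neg_mul_deriv_eq [CharZero F] {A : Type*} [CommRing A] [Algebra F A] {d N : ℕ}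
    (hd : d ≠ 0) {c : F} (hc : c ≠ 0) {γ : F} (hγ : γ = c⁻¹ * (d : F)⁻¹) {x s y q : A}
    (h : x ^ (N + 1) * y = s ^ d + x * q + algebraMap F A c) :
    -algebraMap F A γ * s * (d * s ^ (d - 1)) =
      1 - x * (algebraMap F A c⁻¹ * (x ^ N * y - q)) := by
  have hd' : (d : F) ≠ 0 := Nat.cast_ne_zero.2 hd
  have h1 : algebraMap F A γ * d = algebraMap F A c⁻¹ := by
    rw [hγ, ← map_natCast (algebraMap F A) d, ← map_mul, inv_mul_cancel_right₀ hd']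
  have h2 : algebraMap F A c⁻¹ * algebraMap F A c = 1 := by
    rw [← map_mul, inv_mul_cancel₀ hc, map_one]
  have h3 : s * s ^ (d - 1) = s ^ d := mul_pow_sub_one hd s
  linear_combination (-s * s ^ (d - 1)) * h1 - algebraMap F A c⁻¹ * h3 +
    algebraMap F A c⁻¹ * h + h2

/-- Increasing the exponent by one does not change the cylinder. -/
theorem cyl_succ_equiv [CharZero F] (d : ℕ) (hd : d ≠ 0) (c : F) (hc : c ≠ 0)
    (Q : MvPolynomial (Fin 2) F) (N : ℕ) :
    Nonempty (Polynomial (DanRing F (N + 2) d Q c) ≃ₐ[F]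
      Polynomial (DanRing F (N + 1) d Q c)) := by
  obtain ⟨H, hH⟩ := exists_taylor_remainder d N Q
  obtain ⟨γ, hγ⟩ : ∃ γ, γ = c⁻¹ * (d : F)⁻¹ := ⟨_, rfl⟩
  -- The map to the cylinder with the smaller exponent.
  have rel₁ := cyl_relation (n := N + 1) (d := d) (Q := Q) (c := c)
  set x₁ := cylCoord (N + 1) d Q c 0 with hx₁
  set s₁ := cylCoord (N + 1) d Q c 1 with hs₁
  set y₁ := cylCoord (N + 1) d Q c 2 with hy₁
  have inv₁ := neg_mul_deriv_eq (γ := γ) hd hc hγ rel₁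
  obtain ⟨t₁, ht₁⟩ : ∃ t : Polynomial (DanRing F (N + 1) d Q c), t = Polynomial.X := ⟨_, rfl⟩
  obtain ⟨z₁, hz₁⟩ : ∃ z, z = algebraMap F _ (γ) * s₁ * y₁ + x₁ * t₁ := ⟨_, rfl⟩
  obtain ⟨w₁, hw₁⟩ : ∃ w, w = y₁ * (algebraMap F _ c⁻¹ * (x₁ ^ N * y₁ - aeval ![x₁, s₁] Q)) +
    t₁ * (d * s₁ ^ (d - 1)) + z₁ * aeval ![x₁, s₁, z₁] H := ⟨_, rfl⟩
  have w₁_eq : x₁ * w₁ = y₁ + z₁ * (d * s₁ ^ (d - 1) + x₁ * aeval ![x₁, s₁, z₁] H) := by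
    rw [hw₁]
    linear_combination (-(d * s₁ ^ (d - 1))) * hz₁ + y₁ * inv₁
  obtain ⟨φ, φx, φs, φy, φt⟩ := exists_cyl_lift (n := N + 2) (d := d) (Q := Q) (c := c)
    x₁ (s₁ + x₁ ^ (N + 1) * z₁) w₁ z₁ (by
      linear_combination x₁ ^ (N + 1) * w₁_eq + rel₁ - hH x₁ s₁ z₁)
  -- The map to the cylinder with the larger exponent.
  have rel₂ := cyl_relation (n := N + 2) (d := d) (Q := Q) (c := c)
  set x₂ := cylCoord (N + 2) d Q c 0
  set s₂ := cylCoord (N + 2) d Q c 1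
  set y₂ := cylCoord (N + 2) d Q c 2
  obtain ⟨z₂, hz₂⟩ : ∃ z : Polynomial (DanRing F (N + 2) d Q c), z = Polynomial.X := ⟨_, rfl⟩
  obtain ⟨s, hs⟩ : ∃ s, s = s₂ - x₂ ^ (N + 1) * z₂ := ⟨_, rfl⟩
  obtain ⟨y, hy⟩ : ∃ y, y = x₂ * y₂ - z₂ * (d * s ^ (d - 1) + x₂ * aeval ![x₂, s, z₂] H) :=
    ⟨_, rfl⟩
  obtain ⟨t, ht⟩ : ∃ t, t = algebraMap F _ (γ) * s *
      (z₂ * aeval ![x₂, s, z₂] H - y₂) +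
    z₂ * (algebraMap F _ c⁻¹ * (x₂ ^ N * y - aeval ![x₂, s] Q)) := ⟨_, rfl⟩
  have s₂_eq : s₂ = s + x₂ ^ (N + 1) * z₂ := by rw [hs]; ring
  have rel : x₂ ^ (N + 1) * y = s ^ d + x₂ * aeval ![x₂, s] Q + algebraMap F _ c := by
    rw [s₂_eq] at rel₂
    linear_combination x₂ ^ (N + 1) * hy + rel₂ + hH x₂ s z₂
  have inv₂ := neg_mul_deriv_eq (γ := γ) hd hc hγ rel
  obtain ⟨ψ, ψx, ψs, ψy, ψt⟩ := exists_cyl_lift (n := N + 1) (d := d) (Q := Q) (c := c)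
    x₂ s y t rel
  rw [← hx₁] at ψx
  rw [← hs₁] at ψs
  rw [← hy₁] at ψy
  rw [← ht₁] at ψt
  rw [← hz₂] at φt
  have φs' : φ s = s₁ := by
    rw [hs]
    simp only [map_sub, map_mul, map_pow, φx, φs, φt]
    ring
  have φy' : φ y = y₁ := by
    rw [hy]
    simp only [map_sub, map_add, map_mul, map_pow, map_natCast,
      aeval_vecCons_three, φx, φs', φy, φt]
    linear_combination w₁_eq
  have φt' : φ t = t₁ := by
    rw [ht]
    simp only [map_sub, map_add, map_mul, map_pow, AlgHom.commutes, aeval_vecCons_two,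
      aeval_vecCons_three, φx, φs', φy, φt, φy']
    rw [hw₁]
    linear_combination t₁ * inv₁ +
      algebraMap F _ c⁻¹ * (x₁ ^ N * y₁ - aeval ![x₁, s₁] Q) * hz₁
  have ψz : ψ z₁ = z₂ := by
    rw [hz₁]
    simp only [map_add, map_mul, AlgHom.commutes, ψx, ψs, ψy, ψt]
    rw [ht]
    linear_combination algebraMap F _ (γ) * s * hy + z₂ * inv₂
  have ψw : ψ w₁ = y₂ := by
    rw [hw₁]
    simp only [map_sub, map_add, map_mul, map_pow, map_natCast, AlgHom.commutes,
      aeval_vecCons_two, aeval_vecCons_three, ψx, ψs, ψy, ψt, ψz]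
    rw [ht]
    linear_combination (algebraMap F _ c⁻¹ * (x₂ ^ N * y - aeval ![x₂, s] Q)) * hy +
      (y₂ - z₂ * aeval ![x₂, s, z₂] H) * inv₂
  refine ⟨AlgEquiv.ofAlgHom φ ψ (cyl_algHom_ext (fun i => ?_) ?_)
    (cyl_algHom_ext (fun i => ?_) ?_)⟩
  · fin_cases i
    · exact (congrArg φ ψx).trans φx
    · exact (congrArg φ ψs).trans φs'
    · exact (congrArg φ ψy).trans φy'
  · rw [← ht₁]
    exact (congrArg φ ψt).trans φt'
  · fin_cases i
    · exact (congrArg ψ φx).trans ψx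
    · refine (congrArg ψ φs).trans ?_
      rw [map_add, map_mul, map_pow, ψx, ψs, ψz]
      exact s₂_eq.symm
    · exact (congrArg ψ φy).trans ψw
  · rw [← hz₂]
    exact (congrArg ψ φt).trans ψz

/-- Every cylinder is isomorphic to the one with exponent one. -/
theorem cyl_equiv_one [CharZero F] (d : ℕ) (hd : d ≠ 0) (c : F) (hc : c ≠ 0)
    (Q : MvPolynomial (Fin 2) F) (N : ℕ) :
    Nonempty (Polynomial (DanRing F (N + 1) d Q c) ≃ₐ[F] Polynomial (DanRing F 1 d Q c)) := by
  induction N with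
  | zero => exact ⟨AlgEquiv.refl⟩
  | succ N ih =>
    obtain ⟨e⟩ := ih
    obtain ⟨f⟩ := cyl_succ_equiv d hd c hc Q N
    exact ⟨f.trans e⟩

/-- Cylinders over the Danielewski domains `B_{n,P}`, `P(X,S) = S^d + X·Q(X,S) + c` with
`c ≠ 0`, are isomorphic: `B_{n,P}[T] ≅ B_{m,P}[T]` for all `n, m ≥ 1`. -/
theorem stmt19 (d : ℕ) (hd : 2 ≤ d) (c : k) (hc : c ≠ 0) (Q : MvPolynomial (Fin 2) k)
    (n m : ℕ) (hn : 1 ≤ n) (hm : 1 ≤ m) :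
    Nonempty (Polynomial (DanRing k n d Q c) ≃ₐ[k] Polynomial (DanRing k m d Q c)) := by
  obtain ⟨n, rfl⟩ := Nat.exists_eq_add_of_le' hn
  obtain ⟨m, rfl⟩ := Nat.exists_eq_add_of_le' hm
  obtain ⟨e⟩ := cyl_equiv_one d (by omega) c hc Q n
  obtain ⟨f⟩ := cyl_equiv_one d (by omega) c hc Q m
  exact ⟨e.trans f.symm⟩

end
end
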